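/- Let λ > −1/2 be real and let ν > 0 be real. Then for every x ∈ (−1,1), ʳG_ν^{(λ)}(x) = (Γ(λ+1/2)/(2^ν Γ(ν+λ+1/2))) · (1−x²)^{−λ+1/2} · ( ᴿD₁^ν [ (1−·²)^{ν+λ−1/2} ] )(x), i.e. the GGF-F satisfies the fractional Rodrigues formula with the right-sided Riemann–Liouville fractional derivative of order ν applied to y ↦ (1−y²)^{ν+λ−1/2}. -/

import Mathlib

open Real

/-- Pochhammer symbol `(a)_n = a (a+1) ⋯ (a+n-1)` for a real base. -/
noncomputable def poch (a : ℝ) (n : ℕ) : ℝ := ∏ i ∈ Finset.range n, (a + (i : ℝ))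

/-- The right generalized Gegenbauer function of fractional degree. -/
noncomputable def rG (lam nu x : ℝ) : ℝ :=
  ∑' j : ℕ, (poch (-nu) j * poch (nu + 2 * lam) j /
    ((j.factorial : ℝ) * poch (lam + 1 / 2) j)) * ((1 - x) / 2) ^ j

/-- The right-sided Riemann–Liouville fractional integral on `(−1,1)`. -/
noncomputable def rlInt (s : ℝ) (u : ℝ → ℝ) (x : ℝ) : ℝ :=
  (1 / Real.Gamma s) * ∫ y in x..1, (y - x) ^ (s - 1) * u y

/-- The right-sided Riemann–Liouville fractional derivative of order `s > 0`,
with `k = ⌊s⌋ + 1` (so that `k − 1 ≤ s < k`). -/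
noncomputable def rlDeriv (s : ℝ) (u : ℝ → ℝ) (x : ℝ) : ℝ :=
  (-1 : ℝ) ^ (⌊s⌋₊ + 1) * iteratedDeriv (⌊s⌋₊ + 1) (rlInt ((⌊s⌋₊ : ℝ) + 1 - s) u) x


/-- Polynomially bounded sequences. -/
def PBdd (u : ℕ → ℝ) : Prop := ∃ C : ℝ, ∃ m : ℕ, 0 ≤ C ∧ ∀ j : ℕ, |u j| ≤ C * ((j : ℝ) + 1) ^ m

lemma PBdd.mul {u v : ℕ → ℝ} (hu : PBdd u) (hv : PBdd v) : PBdd (fun j => u j * v j) := by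
  obtain ⟨C, m, hC, h⟩ := hu
  obtain ⟨D, n, hD, k⟩ := hv
  refine ⟨C * D, m + n, by positivity, fun j => ?_⟩
  rw [abs_mul]
  calc |u j| * |v j| ≤ (C * ((j : ℝ) + 1) ^ m) * (D * ((j : ℝ) + 1) ^ n) := by
        gcongr
        · exact h j
        · exact k j
    _ = _ := by rw [pow_add]; ring

lemma PBdd.const_mul {u : ℕ → ℝ} (c : ℝ) (hu : PBdd u) : PBdd (fun j => c * u j) :=
  PBdd.mul (u := fun _ => c) ⟨|c|, 0, abs_nonneg _, fun j => by simp⟩ hu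

lemma PBdd.linear (p : ℝ) : PBdd (fun j => p + (j : ℝ)) := by
  refine ⟨|p| + 1, 1, by positivity, fun j => ?_⟩
  have h1 : |p + (j : ℝ)| ≤ |p| + j := (abs_add_le _ _).trans (by simp)
  have h2 : (0 : ℝ) ≤ j := by positivity
  have h3 := abs_nonneg p
  rw [pow_one]
  nlinarith

lemma PBdd.of_ratio {u q : ℕ → ℝ} (m : ℕ) (hq : ∀ j, u (j + 1) = q j * u j)
    (hb : ∀ j : ℕ, |q j| * ((j : ℝ) + 1) ≤ (j : ℝ) + 1 + m) : PBdd u := by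
  refine ⟨|u 0|, m, abs_nonneg _, fun j => ?_⟩
  induction j with
  | zero => simp
  | succ j ih =>
    rw [hq, abs_mul]
    have hj : (0 : ℝ) < (j : ℝ) + 1 := by positivity
    have hq' : |q j| ≤ 1 + m * (1 / ((j : ℝ) + 1)) := by
      have := hb j
      rw [← le_div_iff₀ hj] at this
      refine this.trans (le_of_eq ?_)
      field_simp
    have hB : 1 + (m : ℝ) * (1 / ((j : ℝ) + 1)) ≤ (1 + 1 / ((j : ℝ) + 1)) ^ m :=
      one_add_mul_le_pow (le_trans (by norm_num) (by positivity : (0 : ℝ) ≤ 1 / ((j : ℝ) + 1))) m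
    calc |q j| * |u j| ≤ (1 + 1 / ((j : ℝ) + 1)) ^ m * (|u 0| * ((j : ℝ) + 1) ^ m) := by
          gcongr
          exact hq'.trans hB
      _ = |u 0| * ((1 + 1 / ((j : ℝ) + 1)) * ((j : ℝ) + 1)) ^ m := by rw [mul_pow]; ring
      _ = |u 0| * (((j + 1 : ℕ) : ℝ) + 1) ^ m := by
          congr 2
          push_cast
          field_simp

lemma PBdd.summable {u : ℕ → ℝ} (hu : PBdd u) {r : ℝ} (hr : |r| < 1) :
    Summable (fun j => ‖u j * r ^ j‖) := by
  obtain ⟨C, m, hC, h⟩ := hu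
  have h1 : Summable (fun j : ℕ => ((j : ℝ) + 1) ^ m * |r| ^ j) := by
    by_cases h0 : r = 0
    · apply summable_of_ne_finset_zero (s := {0})
      intro b hb
      simp only [Finset.mem_singleton] at hb
      simp [h0, hb]
    have h2 := summable_pow_mul_geometric_of_norm_lt_one m (r := |r|) (by simpa using hr)
    have h3 := (summable_nat_add_iff 1).2 h2
    refine (h3.mul_left (|r|⁻¹)).congr fun j => ?_
    have : |r| ≠ 0 := by simpa using h0
    push_cast
    field_simp
    ring
  refine Summable.of_nonneg_of_le (fun _ => norm_nonneg _) (fun j => ?_) (h1.mul_left C)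
  rw [Real.norm_eq_abs, abs_mul, abs_pow, ← mul_assoc]
  gcongr
  exact h j

lemma poch_zero (a : ℝ) : poch a 0 = 1 := by simp [poch]

lemma poch_succ (a : ℝ) (n : ℕ) : poch a (n + 1) = poch a n * (a + n) := by
  simp [poch, Finset.prod_range_succ]

lemma poch_pos {a : ℝ} (ha : 0 < a) (n : ℕ) : 0 < poch a n :=
  Finset.prod_pos fun i _ => by positivity

lemma Gamma_poch {a : ℝ} (ha : 0 < a) (n : ℕ) :
    Real.Gamma (a + n) = Real.Gamma a * poch a n := by
  induction n with
  | zero => simp [poch_zero]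
  | succ n ih =>
    have : a + ((n + 1 : ℕ) : ℝ) = (a + n) + 1 := by push_cast; ring
    rw [this, Real.Gamma_add_one (by positivity), ih, poch_succ]
    ring

lemma PBdd.poch_div_fact (a : ℝ) : PBdd (fun j => poch a j / (j.factorial : ℝ)) := by
  obtain ⟨m, hm⟩ := exists_nat_ge |a|
  refine PBdd.of_ratio (q := fun j => (a + j) / ((j : ℝ) + 1)) m (fun j => ?_) (fun j => ?_)
  · rw [poch_succ, Nat.factorial_succ]
    push_cast
    field_simp
  · rw [abs_div, abs_of_pos (by positivity : (0 : ℝ) < (j : ℝ) + 1), div_mul_cancel₀ _ (by positivity)]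
    have h1 : |a + (j : ℝ)| ≤ |a| + j := (abs_add_le _ _).trans (by simp)
    linarith

lemma PBdd.fact_div_poch {c : ℝ} (hc : 0 < c) : PBdd (fun j => (j.factorial : ℝ) / poch c j) := by
  obtain ⟨m, hm⟩ := exists_nat_ge (1 + 1 / c)
  refine PBdd.of_ratio (q := fun j => ((j : ℝ) + 1) / (c + j)) m (fun j => ?_) (fun j => ?_)
  · have := poch_pos hc j
    rw [poch_succ, Nat.factorial_succ]
    push_cast
    field_simp
  · have hp : (0 : ℝ) < c + j := by positivity
    rw [abs_of_pos (by positivity), div_mul_eq_mul_div, div_le_iff₀ hp]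
    have h1 : 1 ≤ (m : ℝ) := le_trans (by simp; positivity) hm
    have h2 : 1 ≤ (m : ℝ) * c := by
      rw [← div_le_iff₀ hc]; linarith
    have h3 : (0 : ℝ) ≤ j := by positivity
    nlinarith

/-- Hypergeometric coefficients. -/
noncomputable def hyp (a b c : ℝ) (j : ℕ) : ℝ :=
  poch a j * poch b j / ((j.factorial : ℝ) * poch c j)

lemma hyp_zero (a b c : ℝ) : hyp a b c 0 = 1 := by simp [hyp, poch_zero]

lemma hyp_succ (a b : ℝ) {c : ℝ} (hc : 0 < c) (n : ℕ) :
    ((n : ℝ) + 1) * (n + c) * hyp a b c (n + 1) = (n + a) * (n + b) * hyp a b c n := by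
  have := poch_pos hc n
  have h2 : 0 < c + n := by positivity
  have h3 : (n : ℝ) + c = c + n := add_comm _ _
  simp only [hyp, poch_succ, Nat.factorial_succ]
  push_cast
  rw [h3]
  field_simp
  ring

lemma PBdd.hyp (a b : ℝ) {c : ℝ} (hc : 0 < c) : PBdd (hyp a b c) := by
  have h := ((PBdd.poch_div_fact a).mul (PBdd.poch_div_fact b)).mul (PBdd.fact_div_poch hc)
  convert h using 2 with j
  have := poch_pos hc j
  simp only [_root_.hyp]
  field_simp

lemma binom_hasSum (s : ℝ) {t : ℝ} (ht : |t| < 1) :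
    HasSum (fun n : ℕ => poch s n / (n.factorial : ℝ) * t ^ n) ((1 - t) ^ (-s)) := by
  have h := (Real.one_div_one_sub_rpow_hasFPowerSeriesOnBall_zero s).hasSum (y := t)
    (by simpa [enorm_eq_nnnorm, ← NNReal.coe_lt_coe] using ht)
  simp only [FormalMultilinearSeries.ofScalars_apply_eq, zero_add, smul_eq_mul] at h
  rw [Real.rpow_neg (by linarith [(abs_lt.1 ht).2]), ← one_div]
  convert h using 2 with n
  congr 1
  rw [Ring.choose_eq_smul, smul_eq_mul, div_eq_inv_mul]
  congr 1
  rw [Polynomial.descPochhammer_smeval_eq_ascPochhammer,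
    Polynomial.ascPochhammer_smeval_eq_eval, poch]
  rw [show s + n - 1 - n + 1 = s by ring]
  congr 1
  induction n with
  | zero => simp
  | succ n ih => rw [Finset.prod_range_succ, ih, ascPochhammer_succ_eval]

open PowerSeries in
/-- Euler operator. -/
noncomputable def thetaOp (f : PowerSeries ℝ) : PowerSeries ℝ := X * PowerSeries.derivative ℝ f

open PowerSeries in
lemma thetaOp_coeff (f : PowerSeries ℝ) (n : ℕ) : coeff n (thetaOp f) = n * coeff n f := by
  cases n with
  | zero => simp [thetaOp]
  | succ n =>
    rw [thetaOp, coeff_succ_X_mul, coeff_derivative]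
    push_cast; ring

open PowerSeries in
lemma thetaOp_mul (f g : PowerSeries ℝ) : thetaOp (f * g) = thetaOp f * g + f * thetaOp g := by
  simp only [thetaOp, Derivation.leibniz, smul_eq_mul]; ring

open PowerSeries in
lemma hyp_ode (a b c : ℝ) (f : PowerSeries ℝ) :
    (thetaOp (thetaOp f) + C (c - 1) * thetaOp f =
      X * (thetaOp (thetaOp f) + (C a + C b) * thetaOp f + C (a * b) * f)) ↔
    ∀ n : ℕ, ((n : ℝ) + 1) * (n + c) * coeff (n + 1) f = (n + a) * (n + b) * coeff n f := by
  rw [PowerSeries.ext_iff]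
  constructor
  · intro h n
    have := h (n + 1)
    simp only [add_mul, map_add, coeff_succ_X_mul, coeff_C_mul, thetaOp_coeff] at this
    push_cast at this
    linear_combination this
  · intro h n
    cases n with
    | zero => simp [thetaOp]
    | succ n =>
      simp only [add_mul, map_add, coeff_succ_X_mul, coeff_C_mul, thetaOp_coeff]
      push_cast
      linear_combination h n

open PowerSeries in
lemma euler_formal (a b : ℝ) {c : ℝ} (hc : 0 < c) :
    PowerSeries.mk (fun n => poch (c - a - b) n / (n.factorial : ℝ)) * PowerSeries.mk (hyp a b c) =
      PowerSeries.mk (hyp (c - a) (c - b) c) := by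
  set G : PowerSeries ℝ := PowerSeries.mk (fun n => poch (c - a - b) n / (n.factorial : ℝ)) with hG
  set F : PowerSeries ℝ := PowerSeries.mk (hyp a b c) with hF
  have eF := (hyp_ode a b c F).2 (fun n => by simpa [hF] using hyp_succ a b hc n)
  have e1 : thetaOp G = X * (thetaOp G + C (c - a - b) * G) := by
    ext n
    cases n with
    | zero => simp [thetaOp]
    | succ n =>
      simp only [map_add, coeff_succ_X_mul, coeff_C_mul, thetaOp_coeff, hG, coeff_mk, poch_succ,
        Nat.factorial_succ]
      push_cast
      field_simp
      ring
  have tadd : ∀ f g, thetaOp (f + g) = thetaOp f + thetaOp g := fun f g => by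
    simp [thetaOp, mul_add]
  have tX : thetaOp X = X := by simp [thetaOp]
  have tC : ∀ r : ℝ, thetaOp (C r) = 0 := fun r => by simp [thetaOp]
  have e2 := congrArg thetaOp e1
  rw [thetaOp_mul, tadd, thetaOp_mul, tX, tC] at e2
  have key := (hyp_ode (c - a) (c - b) c (G * F)).1 (by
    simp only [thetaOp_mul, tadd]
    simp only [map_sub, map_mul, map_one] at eF e1 e2 ⊢
    linear_combination F * e2 + 2 * thetaOp F * e1 + G * eF + (C c - 1) * F * e1)
  ext n
  rw [coeff_mk]
  induction n with
  | zero => simp [hG, hF, poch_zero, hyp_zero]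
  | succ n ih =>
    have h1 := key n
    rw [ih, ← hyp_succ _ _ hc] at h1
    exact mul_left_cancel₀ (by positivity) h1

lemma euler_transform (a b : ℝ) {c : ℝ} (hc : 0 < c) {t : ℝ} (ht : |t| < 1) :
    ∑' j, hyp (c - a) (c - b) c j * t ^ j =
      (1 - t) ^ (-(c - a - b)) * ∑' j, hyp a b c j * t ^ j := by
  rw [← (binom_hasSum (c - a - b) ht).tsum_eq,
    tsum_mul_tsum_eq_tsum_sum_antidiagonal_of_summable_norm
      ((PBdd.poch_div_fact (c - a - b)).summable ht) ((PBdd.hyp a b hc).summable ht)]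
  congr 1
  ext n
  have h := congrArg (PowerSeries.coeff n) (euler_formal a b hc)
  rw [PowerSeries.coeff_mul] at h
  simp only [PowerSeries.coeff_mk] at h
  rw [← h, Finset.sum_mul]
  refine Finset.sum_congr rfl fun p hp => ?_
  rw [← Finset.HasAntidiagonal.mem_antidiagonal.1 hp, pow_add]
  ring

lemma beta_scaled {s q : ℝ} (hs : 0 < s) (hq : 0 < q) {x : ℝ} (hx : x < 1) :
    ∫ y in x..1, (y - x) ^ (s - 1) * (1 - y) ^ (q - 1) =
      (1 - x) ^ (s + q - 1) * (Real.Gamma s * Real.Gamma q / Real.Gamma (s + q)) := by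
  have h := Complex.betaIntegral_scaled (s : ℂ) (q : ℂ) (a := 1 - x) (by linarith)
  rw [Complex.betaIntegral_eq_Gamma_mul_div _ _ (by simpa) (by simpa)] at h
  have h2 : ∫ y in x..1, (y - x) ^ (s - 1) * (1 - y) ^ (q - 1) =
      ∫ z in (0:ℝ)..(1 - x), z ^ (s - 1) * ((1 - x) - z) ^ (q - 1) := by
    have h4 := intervalIntegral.integral_comp_sub_right (a := x) (b := 1)
      (fun z => z ^ (s - 1) * ((1 - x) - z) ^ (q - 1)) x
    rw [sub_self] at h4
    rw [← h4]
    simp only [sub_sub_sub_cancel_right]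
  rw [h2]
  have h3 : ((∫ z in (0:ℝ)..(1 - x), z ^ (s - 1) * ((1 - x) - z) ^ (q - 1) : ℝ) : ℂ) =
      ∫ z in (0:ℝ)..(1 - x), (z : ℂ) ^ ((s : ℂ) - 1) * (((1 - x : ℝ) : ℂ) - z) ^ ((q : ℂ) - 1) := by
    rw [← intervalIntegral.integral_ofReal]
    refine intervalIntegral.integral_congr fun z hz => ?_
    rw [Set.uIcc_of_le (by linarith)] at hz
    simp only [Complex.ofReal_mul]
    rw [Complex.ofReal_cpow hz.1, Complex.ofReal_cpow (by linarith [hz.2])]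
    push_cast
    rfl
  apply Complex.ofReal_injective
  rw [h3, h]
  rw [Complex.ofReal_mul, Complex.ofReal_cpow (by linarith)]
  push_cast
  simp only [← Complex.Gamma_ofReal]
  push_cast
  rfl

/-- Fractional power series at `1`. -/
noncomputable def serT (p : ℝ) (d : ℕ → ℝ) (x : ℝ) : ℝ :=
  ∑' j : ℕ, d j / Real.Gamma (p + j + 1) * (1 / 2) ^ j * (1 - x) ^ (p + j)

lemma gamma_step (p : ℝ) (e : ℝ) : p * (e / Real.Gamma (p + 1)) = e / Real.Gamma p := by
  by_cases h : p = 0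
  · simp [h, Real.Gamma_zero]
  · rw [Real.Gamma_add_one h]
    field_simp

lemma serT_term (p : ℝ) (e : ℝ) {x : ℝ} (hx : x < 1) (j : ℕ) :
    e * (1 / 2) ^ j * (1 - x) ^ (p + j) = (1 - x) ^ p * (e * ((1 - x) / 2) ^ j) := by
  rw [Real.rpow_add (by linarith), Real.rpow_natCast, div_pow, div_pow]
  ring

lemma PBdd.step {p : ℝ} {d : ℕ → ℝ} (hd : PBdd (fun j => d j / Real.Gamma (p + j + 1))) :
    PBdd (fun j => d j / Real.Gamma (p - 1 + j + 1)) := by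
  convert (PBdd.linear p).mul hd using 2 with j
  rw [gamma_step]
  congr 2
  ring

lemma serT_hasDerivAt {p : ℝ} {d : ℕ → ℝ} (hd : PBdd (fun j => d j / Real.Gamma (p + j + 1)))
    {x : ℝ} (hx : x ∈ Set.Ioo (-1 : ℝ) 1) :
    HasDerivAt (serT p d) (-serT (p - 1) d x) x := by
  obtain ⟨l, hl1, hlx⟩ := exists_between hx.1
  obtain ⟨r, hxr, hr1⟩ := exists_between hx.2
  have hd' := hd.step
  obtain ⟨M, hM0, hM⟩ : ∃ M : ℝ, 0 ≤ M ∧ ∀ y ∈ Set.Ioo l r, (1 - y) ^ (p - 1) ≤ M := by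
    refine ⟨(1 - l) ^ (p - 1) + (1 - r) ^ (p - 1), ?_, ?_⟩
    · have : 0 ≤ 1 - l := by linarith
      have : 0 ≤ 1 - r := by linarith
      positivity
    · intro y hy
      have h1 : 0 ≤ (1 - l) ^ (p - 1) := Real.rpow_nonneg (by linarith) _
      have h2 : 0 ≤ (1 - r) ^ (p - 1) := Real.rpow_nonneg (by linarith) _
      rcases le_total 0 (p - 1) with hp | hp
      · have := Real.rpow_le_rpow (by linarith [hy.2]) (by linarith [hy.1] : 1 - y ≤ 1 - l) hp
        linarith
      · have := Real.rpow_le_rpow_of_nonpos (by linarith) (by linarith [hy.2] : 1 - r ≤ 1 - y) hp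
        linarith
  have hl : |(1 - l) / 2| < 1 := by rw [abs_lt]; constructor <;> linarith
  have hu := (hd'.summable hl).mul_left M
  have hx2 : |(1 - x) / 2| < 1 := by rw [abs_lt]; constructor <;> linarith [hx.1, hx.2]
  have key := hasDerivAt_tsum_of_isPreconnected (t := Set.Ioo l r) (y₀ := x) (y := x)
    (g := fun (j : ℕ) y => d j / Real.Gamma (p + j + 1) * (1 / 2) ^ j * (1 - y) ^ (p + j))
    (g' := fun (j : ℕ) y =>
      -(d j / Real.Gamma (p - 1 + j + 1) * (1 / 2) ^ j * (1 - y) ^ (p - 1 + j)))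
    hu isOpen_Ioo isPreconnected_Ioo ?_ ?_ ⟨hlx, hxr⟩ ?_ ⟨hlx, hxr⟩
  · rw [tsum_neg] at key
    exact key
  · intro j y hy
    have hy1 : 0 < 1 - y := by linarith [hy.2]
    have h1 : HasDerivAt (fun y : ℝ => 1 - y) (-1) y := by
      simpa using (hasDerivAt_id y).const_sub 1
    have h2 := (h1.rpow_const (p := p + j) (Or.inl hy1.ne')).const_mul
      (d j / Real.Gamma (p + j + 1) * (1 / 2) ^ j)
    refine h2.congr_deriv ?_
    have e1 : p - 1 + (j : ℝ) + 1 = p + j := by ring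
    have e2 : p - 1 + (j : ℝ) = p + j - 1 := by ring
    rw [e1, e2, ← gamma_step (p + j) (d j)]
    ring
  · intro j y hy
    have hy1 : 0 < 1 - y := by linarith [hy.2]
    rw [norm_neg, serT_term _ _ (by linarith), norm_mul, Real.norm_of_nonneg (by positivity)]
    refine mul_le_mul (hM y hy) ?_ (norm_nonneg _) hM0
    rw [norm_mul, norm_mul]
    refine mul_le_mul_of_nonneg_left ?_ (norm_nonneg _)
    rw [norm_pow, norm_pow, Real.norm_of_nonneg (by positivity),
      Real.norm_of_nonneg (by linarith)]
    gcongr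
    exact hy.1.le
  · simp only [serT_term _ _ hx.2]
    exact ((hd.summable hx2).of_norm).mul_left _

lemma serT_iter (k : ℕ) : ∀ {p : ℝ} {d : ℕ → ℝ} {ε : ℝ} {f : ℝ → ℝ},
    PBdd (fun j => d j / Real.Gamma (p + j + 1)) →
    (∀ x ∈ Set.Ioo (-1 : ℝ) 1, f x = ε * serT p d x) →
    ∀ x ∈ Set.Ioo (-1 : ℝ) 1, iteratedDeriv k f x = ε * (-1) ^ k * serT (p - k) d x := by
  induction k with
  | zero => intro p d ε f _ hf x hx; simp [hf x hx]
  | succ k ih =>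
    intro p d ε f hd hf x hx
    rw [iteratedDeriv_succ']
    rw [ih (p := p - 1) (d := d) (ε := -ε) hd.step ?_ x hx]
    · have : p - 1 - (k : ℝ) = p - ((k + 1 : ℕ) : ℝ) := by push_cast; ring
      rw [this]
      ring
    · intro y hy
      have h1 : f =ᶠ[nhds y] fun x => ε * serT p d x :=
        Filter.eventuallyEq_of_mem (isOpen_Ioo.mem_nhds hy) hf
      rw [h1.deriv_eq, ((serT_hasDerivAt hd hy).const_mul ε).deriv]
      ring

lemma PBdd.gamma_ratio {a b : ℝ} (ha : 0 < a) (hb : 0 < b) :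
    PBdd (fun j => Real.Gamma (a + j) / Real.Gamma (b + j)) := by
  have h := (((PBdd.poch_div_fact a).mul (PBdd.fact_div_poch hb))).const_mul
    (Real.Gamma a / Real.Gamma b)
  convert h using 2 with j
  rw [Gamma_poch ha, Gamma_poch hb]
  have := poch_pos hb j
  have := Real.Gamma_pos_of_pos hb
  field_simp

/-- Coefficients for the weight function. -/
noncomputable def wt (mu : ℝ) (j : ℕ) : ℝ :=
  2 ^ mu * (poch (-mu) j / (j.factorial : ℝ)) * Real.Gamma (mu + 1 + j)

lemma PBdd.wt {mu s : ℝ} (hmu : 0 < mu + 1) (hs : 0 < s) :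
    PBdd (fun j => wt mu j / Real.Gamma (mu + s + j + 1)) := by
  have h := ((PBdd.poch_div_fact (-mu)).const_mul (2 ^ mu)).mul
    (PBdd.gamma_ratio hmu (by linarith : 0 < mu + s + 1))
  convert h using 2 with j
  rw [show mu + s + 1 + (j : ℝ) = mu + s + j + 1 by ring]
  simp only [_root_.wt]
  ring

lemma rlInt_eq {mu s : ℝ} (hmu : 0 < mu + 1) (hs : 0 < s) {x : ℝ}
    (hx : x ∈ Set.Ioo (-1 : ℝ) 1) :
    rlInt s (fun y => (1 - y ^ 2) ^ mu) x = serT (mu + s) (wt mu) x := by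
  have hΓ := Real.Gamma_pos_of_pos hs
  have hx0 : 0 < 1 - x := by linarith [hx.2]
  have hx2 : |(1 - x) / 2| < 1 := by rw [abs_lt]; constructor <;> linarith [hx.1, hx.2]
  set a : ℕ → ℝ := fun j => 2 ^ mu * (poch (-mu) j / (j.factorial : ℝ)) * (1 / 2) ^ j with ha
  set B : ℕ → ℝ → ℝ := fun j y => (y - x) ^ (s - 1) * (1 - y) ^ (mu + 1 + j - 1) with hB
  have hq : ∀ j : ℕ, 0 < mu + 1 + j := fun j => by positivity
  have hBint : ∀ j : ℕ, ∫ y in Set.Ioo x 1, B j y =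
      (1 - x) ^ (s + (mu + 1 + j) - 1) *
        (Real.Gamma s * Real.Gamma (mu + 1 + j) / Real.Gamma (s + (mu + 1 + j))) := by
    intro j
    rw [← beta_scaled hs (hq j) hx.2, intervalIntegral.integral_of_le hx.2.le,
      MeasureTheory.integral_Ioc_eq_integral_Ioo]
  have hBi : ∀ j : ℕ, MeasureTheory.IntegrableOn (B j) (Set.Ioo x 1) := by
    intro j
    by_contra h
    have h0 := MeasureTheory.integral_undef h
    rw [hBint j] at h0
    have h1 := Real.Gamma_pos_of_pos (hq j)
    have h2 := Real.Gamma_pos_of_pos (add_pos hs (hq j))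
    have : 0 < (1 - x) ^ (s + (mu + 1 + j) - 1) *
        (Real.Gamma s * Real.Gamma (mu + 1 + j) / Real.Gamma (s + (mu + 1 + j))) := by positivity
    exact this.ne' h0
  have hval : ∀ j : ℕ, a j * ∫ y in Set.Ioo x 1, B j y =
      Real.Gamma s * (wt mu j / Real.Gamma (mu + s + j + 1) * (1 / 2) ^ j *
        (1 - x) ^ (mu + s + j)) := by
    intro j
    rw [hBint, show s + (mu + 1 + (j : ℝ)) - 1 = mu + s + j by ring,
      show s + (mu + 1 + (j : ℝ)) = mu + s + j + 1 by ring, ha, wt]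
    ring
  have hnn : ∀ j : ℕ, ∀ y ∈ Set.Ioo x 1, 0 ≤ B j y := by
    intro j y hy
    have h1 : 0 ≤ y - x := by linarith [hy.1]
    have h2 : 0 ≤ 1 - y := by linarith [hy.2]
    simp only [hB]
    positivity
  have hnorm : ∀ j : ℕ, ∫ y in Set.Ioo x 1, ‖a j * B j y‖ =
      ‖a j * ∫ y in Set.Ioo x 1, B j y‖ := by
    intro j
    rw [norm_mul, Real.norm_of_nonneg
      (MeasureTheory.setIntegral_nonneg measurableSet_Ioo (hnn j)),
      ← MeasureTheory.integral_const_mul]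
    refine MeasureTheory.setIntegral_congr_fun measurableSet_Ioo fun y hy => ?_
    simp only [norm_mul, Real.norm_of_nonneg (hnn j y hy)]
  have hsum := MeasureTheory.hasSum_integral_of_summable_integral_norm
    (μ := MeasureTheory.volume.restrict (Set.Ioo x 1)) (F := fun j y => a j * B j y)
    (fun j => (hBi j).const_mul (a j)) (by
      simp only [hnorm, hval, serT_term _ _ hx.2]
      simp only [← mul_assoc (Real.Gamma s)]
      simp only [norm_mul (Real.Gamma s * (1 - x) ^ (mu + s))]
      exact ((PBdd.wt hmu hs).summable hx2).mul_left _)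
  have hpt : ∀ y ∈ Set.Ioo x 1, ∑' j, a j * B j y = (y - x) ^ (s - 1) * (1 - y ^ 2) ^ mu := by
    intro y hy
    have h1 : 0 < 1 - y := by linarith [hy.2]
    have h2 : 0 < 1 + y := by linarith [hy.1, hx.1]
    have h3 : |(1 - y) / 2| < 1 := by rw [abs_lt]; constructor <;> linarith
    have h4 := (binom_hasSum (-mu) h3).mul_left ((y - x) ^ (s - 1) * (2 ^ mu * (1 - y) ^ mu))
    have h5 : (y - x) ^ (s - 1) * (1 - y ^ 2) ^ mu =
        (y - x) ^ (s - 1) * (2 ^ mu * (1 - y) ^ mu) * (1 - (1 - y) / 2) ^ (- -mu) := by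
      rw [neg_neg, show 1 - (1 - y) / 2 = (1 + y) / 2 by ring,
        show 1 - y ^ 2 = (1 - y) * (1 + y) by ring, Real.mul_rpow h1.le h2.le,
        Real.div_rpow h2.le (by norm_num)]
      have : (0 : ℝ) < 2 ^ mu := by positivity
      field_simp
    rw [h5, ← h4.tsum_eq]
    congr 1
    ext j
    simp only [ha, hB]
    rw [show mu + 1 + (j : ℝ) - 1 = mu + j by ring, Real.rpow_add h1, Real.rpow_natCast,
      div_pow, div_pow]
    ring
  rw [MeasureTheory.setIntegral_congr_fun measurableSet_Ioo hpt] at hsum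
  have h6 := hsum.tsum_eq
  simp only [MeasureTheory.integral_const_mul, hval] at h6
  rw [tsum_mul_left] at h6
  rw [rlInt, intervalIntegral.integral_of_le hx.2.le, MeasureTheory.integral_Ioc_eq_integral_Ioo,
    ← h6, serT]
  field_simp

/-- Fractional Rodrigues formula for the GGF-Fs. -/
theorem ggf_rodrigues (lam nu : ℝ) (hlam : -(1 / 2) < lam) (hnu : 0 < nu)
    (x : ℝ) (hx : x ∈ Set.Ioo (-1 : ℝ) 1) :
    rG lam nu x =
      Real.Gamma (lam + 1 / 2) / (2 ^ nu * Real.Gamma (nu + lam + 1 / 2)) *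
        (1 - x ^ 2) ^ (-lam + 1 / 2) *
        rlDeriv nu (fun y => (1 - y ^ 2) ^ (nu + lam - 1 / 2)) x := by
  have hmu : 0 < (nu + lam - 1 / 2) + 1 := by linarith
  have hs : 0 < (⌊nu⌋₊ : ℝ) + 1 - nu := by linarith [Nat.lt_floor_add_one nu]
  have hc : 0 < lam + 1 / 2 := by linarith
  have h1x : 0 < 1 - x := by linarith [hx.2]
  have h2x : 0 < 1 + x := by linarith [hx.1]
  have ht : |(1 - x) / 2| < 1 := by rw [abs_lt]; constructor <;> linarith
  rw [rlDeriv, serT_iter (⌊nu⌋₊ + 1) (ε := 1) (PBdd.wt hmu hs)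
    (fun y hy => by rw [rlInt_eq hmu hs hy, one_mul]) x hx]
  rw [show nu + lam - 1 / 2 + ((⌊nu⌋₊ : ℝ) + 1 - nu) - ((⌊nu⌋₊ + 1 : ℕ) : ℝ) = lam - 1 / 2 by
    push_cast; ring]
  rw [one_mul, ← mul_assoc ((-1 : ℝ) ^ _), ← mul_pow]
  norm_num only [one_pow, one_mul]
  have hG1 := Real.Gamma_pos_of_pos hc
  have hG2 := Real.Gamma_pos_of_pos hmu
  have hser : serT (lam - 1 / 2) (wt (nu + lam - 1 / 2)) x =
      2 ^ (nu + lam - 1 / 2) * Real.Gamma (nu + lam - 1 / 2 + 1) / Real.Gamma (lam + 1 / 2) *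
        (1 - x) ^ (lam - 1 / 2) *
        ∑' j, hyp (-(nu + lam - 1 / 2)) (nu + lam - 1 / 2 + 1) (lam + 1 / 2) j *
          ((1 - x) / 2) ^ j := by
    rw [serT, ← tsum_mul_left]
    congr 1
    ext j
    rw [serT_term _ _ hx.2, show lam - 1 / 2 + (j : ℝ) + 1 = lam + 1 / 2 + j by ring,
      Gamma_poch hc, wt, Gamma_poch hmu, hyp]
    have := poch_pos hc j
    field_simp
  have heul := euler_transform (-(nu + lam - 1 / 2)) (nu + lam - 1 / 2 + 1) hc ht
  have hrG : rG lam nu x = ∑' j, hyp (lam + 1 / 2 - -(nu + lam - 1 / 2))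
      (lam + 1 / 2 - (nu + lam - 1 / 2 + 1)) (lam + 1 / 2) j * ((1 - x) / 2) ^ j := by
    rw [rG, show lam + 1 / 2 - -(nu + lam - 1 / 2) = nu + 2 * lam by ring,
      show lam + 1 / 2 - (nu + lam - 1 / 2 + 1) = -nu by ring]
    congr 1
    ext j
    rw [hyp, mul_comm (poch (nu + 2 * lam) j)]
  have e1 : nu + lam + 1 / 2 = nu + lam - 1 / 2 + 1 := by ring
  have e2 : -(lam + 1 / 2 - -(nu + lam - 1 / 2) - (nu + lam - 1 / 2 + 1)) = -(lam - 1 / 2) := by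
    ring
  have e3 : 1 - (1 - x) / 2 = (1 + x) / 2 := by ring
  have e4 : -lam + 1 / 2 = -(lam - 1 / 2) := by ring
  have e5 : nu + lam - 1 / 2 = nu + (lam - 1 / 2) := by ring
  have e6 : (2 : ℝ) ^ (nu + lam - 1 / 2) = 2 ^ nu * 2 ^ (lam - 1 / 2) := by
    rw [e5, Real.rpow_add (by norm_num)]
  rw [hrG, heul, hser, e1, e2, e3, e4, e6, show 1 - x ^ 2 = (1 - x) * (1 + x) by ring,
    Real.mul_rpow h1x.le h2x.le, Real.div_rpow h2x.le (by norm_num), Real.rpow_neg h1x.le,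
    Real.rpow_neg h2x.le, Real.rpow_neg (by norm_num : (0 : ℝ) ≤ 2)]
  have := Real.rpow_pos_of_pos h1x (lam - 1 / 2)
  have := Real.rpow_pos_of_pos h2x (lam - 1 / 2)
  have : (0 : ℝ) < 2 ^ (lam - 1 / 2) := by positivity
  have : (0 : ℝ) < 2 ^ nu := by positivity
  generalize (∑' j, hyp (-(nu + lam - 1 / 2)) (nu + lam - 1 / 2 + 1) (lam + 1 / 2) j *
          ((1 - x) / 2) ^ j) = S
  generalize Real.Gamma (nu + lam - 1 / 2 + 1) = g at *
  generalize Real.Gamma (lam + 1 / 2) = g' at *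
  generalize (1 - x) ^ (lam - 1 / 2) = A at *
  generalize (1 + x) ^ (lam - 1 / 2) = B at *
  generalize (2 : ℝ) ^ (lam - 1 / 2) = D at *
  generalize (2 : ℝ) ^ nu = E at *
  field_simp
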